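/- arXiv:2410.13451 — 4 statements merged into one kernel-verified Lean document; each statement's English description precedes it below -/
import Mathlib

section
/- For every finite simple graph G = (V, E) with n ≥ 2 vertices and m ≥ 1 edges and every parameter φ with 0 < φ < 1, there exist universal constants c₁, c₂ > 0 (independent of G and φ) and a partition V₁, …, V_k of V such that each induced subgraph G[Vᵢ] is a φ-expander and the number of crossing edges satisfies Σ_{i<j} |E_G(Vᵢ, Vⱼ)| ≤ c₁ · φ · m · (log n)^{c₂}. -/
open Finset

variable {V : Type}

/-- The volume `deg_G(S) = ∑_{v ∈ S} deg_G(v)` of a vertex set. -/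
def degSum (G : SimpleGraph V) [Fintype V] [DecidableRel G.Adj] (S : Finset V) : ℕ :=
  ∑ v ∈ S, G.degree v

/-- The number of edges of `G` between the disjoint sets `S` and `T`
(counted as ordered pairs `(s, t)` with `s ∈ S`, `t ∈ T`, `s ~ t`). -/
def interEdges (G : SimpleGraph V) [Fintype V] [DecidableEq V] [DecidableRel G.Adj]
    (S T : Finset V) : ℕ :=
  ((S ×ˢ T).filter fun p => G.Adj p.1 p.2).card

/-- The degree of `v` in the induced subgraph `G[A]`. -/
def indDeg (G : SimpleGraph V) [DecidableEq V] [DecidableRel G.Adj]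
    (A : Finset V) (v : V) : ℕ :=
  (A.filter fun u => G.Adj v u).card

/-- The volume of `S` in the induced subgraph `G[A]`. -/
def indDegSum (G : SimpleGraph V) [DecidableEq V] [DecidableRel G.Adj]
    (A S : Finset V) : ℕ :=
  ∑ v ∈ S, indDeg G A v

/-- The induced subgraph `G[A]` is a `φ`-expander. -/
def IsExpanderOn (G : SimpleGraph V) [Fintype V] [DecidableEq V] [DecidableRel G.Adj]
    (A : Finset V) (φ : ℝ) : Prop :=
  ∀ S ⊆ A,
    φ * min (indDegSum G A S : ℝ) (indDegSum G A (A \ S)) ≤ interEdges G S (A \ S)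

/-- `G[A]` is a `φ`-nearly expander in `G`. -/
def IsNearlyExpanderIn (G : SimpleGraph V) [Fintype V] [DecidableEq V] [DecidableRel G.Adj]
    (A : Finset V) (φ : ℝ) : Prop :=
  ∀ S ⊆ A, (degSum G S : ℝ) ≤ degSum G (A \ S) →
    φ * degSum G S ≤ interEdges G S (Finset.univ \ S)

theorem ie_eq_sum {V : Type} (G : SimpleGraph V) [Fintype V] [DecidableEq V] [DecidableRel G.Adj]
    (S T : Finset V) :
    (interEdges G S T : ℝ) = ∑ u ∈ S, ∑ v ∈ T, if G.Adj u v then (1 : ℝ) else 0 := by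
  unfold interEdges
  rw [Finset.card_filter, Finset.sum_product]
  push_cast
  rfl

theorem ie_comm {V : Type} (G : SimpleGraph V) [Fintype V] [DecidableEq V] [DecidableRel G.Adj]
    (S T : Finset V) : (interEdges G S T : ℝ) = interEdges G T S := by
  rw [ie_eq_sum, ie_eq_sum, Finset.sum_comm]
  simp only [G.adj_comm]

theorem ind_eq {V : Type} (G : SimpleGraph V) [Fintype V] [DecidableEq V] [DecidableRel G.Adj]
    (A S : Finset V) : (indDegSum G A S : ℝ) = interEdges G S A := by
  rw [ie_eq_sum]
  unfold indDegSum indDeg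
  simp only [Finset.card_filter]
  push_cast
  rfl

theorem ie_split_left {V : Type} (G : SimpleGraph V) [Fintype V] [DecidableEq V]
    [DecidableRel G.Adj] {A S : Finset V} (h : S ⊆ A) (T : Finset V) :
    (interEdges G A T : ℝ) = interEdges G S T + interEdges G (A \ S) T := by
  simp only [ie_eq_sum]
  rw [← Finset.sum_sdiff h, add_comm]

theorem ie_split_right {V : Type} (G : SimpleGraph V) [Fintype V] [DecidableEq V]
    [DecidableRel G.Adj] {A S : Finset V} (h : S ⊆ A) (T : Finset V) :
    (interEdges G T A : ℝ) = interEdges G T S + interEdges G T (A \ S) := by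
  rw [ie_comm, ie_split_left G h, ie_comm G S, ie_comm G (A \ S)]

theorem xlogx_mono (a b : ℕ) (h : (a : ℝ) ≤ b) :
    (a : ℝ) * Real.log a ≤ b * Real.log b := by
  rcases Nat.eq_zero_or_pos a with rfl | ha
  · simpa using mul_nonneg (Nat.cast_nonneg b) (Real.log_natCast_nonneg b)
  · have : (0 : ℝ) < a := by exact_mod_cast ha
    exact mul_le_mul h (Real.log_le_log this h) (Real.log_natCast_nonneg a) (by positivity)

theorem arith_step (s t : ℝ) (hs : 0 < s) (hst : s ≤ t) :
    s * Real.log s + t * Real.log t + s * Real.log 2 ≤ (s + t) * Real.log (s + t) := by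
  have h1 : Real.log s + Real.log 2 ≤ Real.log (s + t) := by
    rw [← Real.log_mul hs.ne' (by norm_num)]
    exact Real.log_le_log (by positivity) (by linarith)
  have h2 : Real.log t ≤ Real.log (s + t) := Real.log_le_log (by linarith) (by linarith)
  nlinarith [mul_le_mul_of_nonneg_left h1 hs.le,
    mul_le_mul_of_nonneg_left h2 (hs.le.trans hst)]

theorem decomp_aux {V : Type} (G : SimpleGraph V) [Fintype V] [DecidableEq V]
    [DecidableRel G.Adj] (φ : ℝ) (hφ : 0 < φ) :
    ∀ (n : ℕ) (A : Finset V), A.card ≤ n → ∃ P : Finset (Finset V),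
      (P : Set (Finset V)).PairwiseDisjoint id ∧ P.biUnion id = A ∧ ∅ ∉ P ∧
      (∀ p ∈ P, IsExpanderOn G p φ) ∧
      (interEdges G A A : ℝ) - 2 / Real.log 2 * φ * (interEdges G A A *
        Real.log (interEdges G A A)) ≤ ∑ p ∈ P, (interEdges G p p : ℝ) := by
  have hl2 : 0 < Real.log 2 := Real.log_pos (by norm_num)
  intro n
  induction n with
  | zero =>
    intro A hA
    have : A = ∅ := by simpa using hA
    subst this
    exact ⟨∅, by simp, by simp, by simp, by simp, by simp [interEdges]⟩
  | succ n ih =>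
    intro A hA
    rcases A.eq_empty_or_nonempty with rfl | hne
    · exact ⟨∅, by simp, by simp, by simp, by simp, by simp [interEdges]⟩
    by_cases hE : IsExpanderOn G A φ
    · refine ⟨{A}, by simp, by simp, by simpa using hne.ne_empty.symm, by simpa using hE, ?_⟩
      rw [Finset.sum_singleton]
      have := mul_nonneg (Nat.cast_nonneg (α := ℝ) (interEdges G A A))
        (Real.log_natCast_nonneg (interEdges G A A))
      have : 0 ≤ 2 / Real.log 2 * φ * (interEdges G A A *
        Real.log (interEdges G A A)) := by positivity
      linarith
    · have key : ∃ S ⊆ A, (interEdges G S A : ℝ) ≤ interEdges G (A \ S) A ∧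
          (interEdges G S (A \ S) : ℝ) < φ * interEdges G S A := by
        unfold IsExpanderOn at hE
        push Not at hE
        obtain ⟨S, hS, hlt⟩ := hE
        rw [ind_eq, ind_eq] at hlt
        rcases le_total (interEdges G S A : ℝ) (interEdges G (A \ S) A) with h | h
        · exact ⟨S, hS, h, by rwa [min_eq_left h] at hlt⟩
        · refine ⟨A \ S, Finset.sdiff_subset, ?_, ?_⟩
          · rwa [Finset.sdiff_sdiff_eq_self hS]
          · rw [Finset.sdiff_sdiff_eq_self hS, ie_comm]
            rwa [min_eq_right h] at hlt
      obtain ⟨S, hS, hle, hlt⟩ := key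
      have hspos : (0 : ℝ) < interEdges G S A := by
        have : (0 : ℝ) ≤ interEdges G S (A \ S) := Nat.cast_nonneg _
        exact pos_of_mul_pos_right (this.trans_lt hlt) hφ.le
      have hSne : S ≠ ∅ := by
        rintro rfl
        simp [interEdges] at hspos
      have hSA : S ≠ A := by
        rintro rfl
        have h0 : interEdges G (S \ S) S = 0 := by simp [interEdges]
        rw [h0] at hle
        push_cast at hle
        linarith
      have hc1 : S.card < A.card := Finset.card_lt_card (hS.ssubset_of_ne hSA)
      have hc2 : (A \ S).card < A.card := by
        rw [Finset.card_sdiff_of_subset hS]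
        have := Finset.card_pos.2 (Finset.nonempty_iff_ne_empty.2 hSne)
        omega
      obtain ⟨P, hP1, hP2, hP3, hP4, hP5⟩ := ih S (by omega)
      obtain ⟨Q, hQ1, hQ2, hQ3, hQ4, hQ5⟩ := ih (A \ S) (by omega)
      have hPQ : ∀ p ∈ P, ∀ q ∈ Q, Disjoint p q := by
        intro p hp q hq
        have h1 : p ⊆ S := hP2 ▸ Finset.subset_biUnion_of_mem id hp
        have h2 : q ⊆ A \ S := hQ2 ▸ Finset.subset_biUnion_of_mem id hq
        exact Finset.disjoint_of_subset_left h1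
          (Finset.disjoint_of_subset_right h2 Finset.disjoint_sdiff)
      have hdisj : Disjoint P Q := by
        rw [Finset.disjoint_left]
        intro p hp hq
        have := hPQ p hp p hq
        rw [disjoint_self] at this
        exact hP3 (by simpa [this] using hp)
      refine ⟨P ∪ Q, ?_, ?_, ?_, ?_, ?_⟩
      · intro p hp q hq hne
        simp only [Finset.coe_union, Set.mem_union, Finset.mem_coe] at hp hq
        rcases hp with hp | hp <;> rcases hq with hq | hq
        · exact hP1 hp hq hne
        · exact hPQ p hp q hq
        · exact (hPQ q hq p hp).symm
        · exact hQ1 hp hq hne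
      · rw [Finset.union_biUnion, hP2, hQ2, Finset.union_sdiff_of_subset hS]
      · simp [hP3, hQ3]
      · intro p hp
        rcases Finset.mem_union.1 hp with h | h
        · exact hP4 p h
        · exact hQ4 p h
      · rw [Finset.sum_union hdisj]
        have e1 := ie_split_left G hS A
        have e2 := ie_split_right G hS S
        have e3 := ie_split_right G hS (A \ S)
        have e4 := ie_comm G (A \ S) S
        have m1 := xlogx_mono (interEdges G S S) (interEdges G S A)
          (by rw [e2]; linarith [Nat.cast_nonneg (α := ℝ) (interEdges G S (A \ S))])
        have m2 := xlogx_mono (interEdges G (A \ S) (A \ S)) (interEdges G (A \ S) A)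
          (by rw [e3]; linarith [Nat.cast_nonneg (α := ℝ) (interEdges G (A \ S) S)])
        have ar := arith_step _ _ hspos hle
        rw [← e1] at ar
        have hK : 0 ≤ 2 / Real.log 2 * φ := by positivity
        have ar2 := mul_le_mul_of_nonneg_left
          ((add_le_add (add_le_add m1 m2) le_rfl).trans ar) hK
        have e5 : 2 / Real.log 2 * φ * ((interEdges G S A : ℝ) * Real.log 2) =
            2 * (φ * interEdges G S A) := by
          field_simp
        rw [mul_add, mul_add, e5] at ar2
        linarith

/-- **Parallel Expander Decomposition** (Theorem 1.1, existential content):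
there are universal constants `c₁, c₂ > 0` such that every graph with `n ≥ 2` vertices
and `m ≥ 1` edges admits, for every `φ ∈ (0,1)`, a partition into `φ`-expanders with at
most `c₁ · φ · m · (log n)^c₂` crossing edges. -/
theorem expander_decomposition :
    ∃ c₁ c₂ : ℝ, 0 < c₁ ∧ 0 < c₂ ∧
      ∀ (V : Type) [Fintype V] [DecidableEq V] (G : SimpleGraph V) [DecidableRel G.Adj]
        (φ : ℝ), 2 ≤ Fintype.card V → 1 ≤ G.edgeFinset.card → 0 < φ → φ < 1 →
        ∃ P : Finpartition (Finset.univ : Finset V),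
          (∀ p ∈ P.parts, IsExpanderOn G p φ) ∧
          (∑ p ∈ P.parts, ∑ q ∈ P.parts \ {p}, (interEdges G p q : ℝ)) / 2 ≤
            c₁ * φ * G.edgeFinset.card * Real.log (Fintype.card V) ^ c₂ := by
  have hl2 : 0 < Real.log 2 := Real.log_pos (by norm_num)
  refine ⟨4 / Real.log 2, 1, by positivity, one_pos, ?_⟩
  intro V _ _ G _ φ hn hm hφ _
  obtain ⟨P, hP1, hP2, hP3, hP4, hP5⟩ := decomp_aux G φ hφ _ Finset.univ le_rfl
  refine ⟨⟨P, Finset.supIndep_iff_pairwiseDisjoint.2 hP1, ?_, hP3⟩, hP4, ?_⟩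
  · rw [Finset.sup_eq_biUnion, hP2]
  · have h2m : (interEdges G univ univ : ℝ) = 2 * G.edgeFinset.card := by
      rw [← ind_eq]
      have := G.sum_degrees_eq_twice_card_edges
      have h : indDegSum G univ univ = ∑ v, G.degree v := by
        unfold indDegSum indDeg
        refine Finset.sum_congr rfl fun v _ => ?_
        rw [← G.card_neighborFinset_eq_degree, G.neighborFinset_eq_filter]
      rw [h, this]
      push_cast
      rfl
    have hsum : ∑ p ∈ P, ∑ q ∈ P, (interEdges G p q : ℝ) = interEdges G univ univ := by
      have hr : ∀ T : Finset V, ∑ q ∈ P, (interEdges G q T : ℝ) = interEdges G univ T := by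
        intro T
        simp only [ie_eq_sum]
        rw [← hP2, Finset.sum_biUnion hP1]
        rfl
      rw [Finset.sum_comm]
      simp only [hr]
      simp only [ie_comm G univ]
      exact hr univ
    have hcr : ∑ p ∈ P, ∑ q ∈ P \ {p}, (interEdges G p q : ℝ) =
        interEdges G univ univ - ∑ p ∈ P, (interEdges G p p : ℝ) := by
      rw [← hsum, ← Finset.sum_sub_distrib]
      refine Finset.sum_congr rfl fun p hp => ?_
      rw [← Finset.sum_sdiff (Finset.singleton_subset_iff.2 hp), Finset.sum_singleton]
      ring
    change (∑ p ∈ P, ∑ q ∈ P \ {p}, (interEdges G p q : ℝ)) / 2 ≤ _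
    rw [hcr, Real.rpow_one]
    have hlog : Real.log (interEdges G univ univ) ≤ 2 * Real.log (Fintype.card V) := by
      have hpos : (0 : ℝ) < interEdges G univ univ := by
        rw [h2m]
        have : (1 : ℝ) ≤ G.edgeFinset.card := by exact_mod_cast hm
        linarith
      have hle : (interEdges G univ univ : ℝ) ≤ (Fintype.card V : ℝ) ^ 2 := by
        have : interEdges G univ univ ≤ Fintype.card V ^ 2 := by
          unfold interEdges
          refine (Finset.card_filter_le _ _).trans ?_
          rw [Finset.card_product, Finset.card_univ, sq]
        exact_mod_cast this
      have := Real.log_le_log hpos hle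
      rw [Real.log_pow] at this
      exact_mod_cast this
    have hK : 0 ≤ 2 / Real.log 2 * φ * (interEdges G univ univ : ℝ) := by positivity
    have h3 := mul_le_mul_of_nonneg_left hlog hK
    have h4 : 2 / Real.log 2 * φ * (interEdges G univ univ : ℝ) *
        (2 * Real.log (Fintype.card V)) =
        2 * (4 / Real.log 2 * φ * G.edgeFinset.card * Real.log (Fintype.card V)) := by
      rw [h2m]
      ring
    rw [h4] at h3
    rw [← mul_assoc] at hP5
    linarith
end

section
/- Let G = (V, E) be a finite simple graph with n ≥ 2 vertices and m edges, let φ ∈ (0, 1), and let A ⊆ V be such that G[A] is a φ-nearly expander in G and |E_G(A, V∖A)| ≤ φ·m. Then there exists A' ⊆ A such that: (1) G[A'] is a (φ/6)-expander; (2) deg_G(A') ≥ deg_G(A) − (4·(log₂ n)²/φ)·|E_G(A, V∖A)|; and (3) |E_G(A', V∖A')| ≤ 2·|E_G(A, V∖A)|. -/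
open Finset

variable {V : Type}

theorem interEdges_eq_sum (G : SimpleGraph V) [Fintype V] [DecidableEq V] [DecidableRel G.Adj]
    (S T : Finset V) :
    interEdges G S T = ∑ s ∈ S, ∑ t ∈ T, if G.Adj s t then 1 else 0 := by
  unfold interEdges
  rw [Finset.card_filter, Finset.sum_product]

theorem interEdges_symm (G : SimpleGraph V) [Fintype V] [DecidableEq V] [DecidableRel G.Adj]
    (S T : Finset V) : interEdges G S T = interEdges G T S := by
  rw [interEdges_eq_sum, interEdges_eq_sum, Finset.sum_comm]
  simp only [G.adj_comm]

theorem interEdges_union_right (G : SimpleGraph V) [Fintype V] [DecidableEq V]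
    [DecidableRel G.Adj] (S T U : Finset V) (h : Disjoint T U) :
    interEdges G S (T ∪ U) = interEdges G S T + interEdges G S U := by
  simp only [interEdges_eq_sum, Finset.sum_union h, Finset.sum_add_distrib]

theorem interEdges_union_left (G : SimpleGraph V) [Fintype V] [DecidableEq V]
    [DecidableRel G.Adj] (S T U : Finset V) (h : Disjoint T U) :
    interEdges G (T ∪ U) S = interEdges G T S + interEdges G U S := by
  simp only [interEdges_eq_sum, Finset.sum_union h]

/-- How the cut changes when `S` is removed from `B`. -/
theorem cut_sdiff (G : SimpleGraph V) [Fintype V] [DecidableEq V]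
    [DecidableRel G.Adj] (B S : Finset V) (h : S ⊆ B) :
    interEdges G (B \ S) (univ \ (B \ S)) + interEdges G S (univ \ S) =
      interEdges G B (univ \ B) + 2 * interEdges G S (B \ S) := by
  have e1 : univ \ (B \ S) = (univ \ B) ∪ S := by ext x; have := @h x; simp; tauto
  have e2 : univ \ S = (univ \ B) ∪ (B \ S) := by ext x; have := @h x; simp; tauto
  have d1 : Disjoint (univ \ B) S := by
    rw [Finset.disjoint_left]; intro x hx hS; simp at hx; exact hx (h hS)
  have d2 : Disjoint (univ \ B) (B \ S) := by
    rw [Finset.disjoint_left]; intro x hx hS; simp at hx hS; exact hx hS.1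
  have e3 : interEdges G B (univ \ B) =
      interEdges G (B \ S) (univ \ B) + interEdges G S (univ \ B) := by
    rw [← interEdges_union_left _ _ _ _ Finset.sdiff_disjoint, Finset.sdiff_union_of_subset h]
  rw [e1, e2, e3, interEdges_union_right _ _ _ _ d1, interEdges_union_right _ _ _ _ d2,
    interEdges_symm G (B \ S) S]
  ring

theorem indDegSum_le_degSum (G : SimpleGraph V) [Fintype V] [DecidableEq V]
    [DecidableRel G.Adj] (B S : Finset V) : indDegSum G B S ≤ degSum G S := by
  unfold indDegSum degSum
  refine Finset.sum_le_sum fun v _ => ?_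
  unfold indDeg
  rw [← SimpleGraph.card_neighborFinset_eq_degree]
  refine Finset.card_le_card fun u hu => ?_
  simpa using (Finset.mem_filter.1 hu).2

theorem degSum_sdiff_add (G : SimpleGraph V) [Fintype V] [DecidableEq V]
    [DecidableRel G.Adj] (B S : Finset V) (h : S ⊆ B) :
    degSum G (B \ S) + degSum G S = degSum G B := Finset.sum_sdiff h

theorem degSum_mono (G : SimpleGraph V) [Fintype V] [DecidableEq V]
    [DecidableRel G.Adj] {B S : Finset V} (h : S ⊆ B) :
    degSum G S ≤ degSum G B := Finset.sum_le_sum_of_subset h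

/-- A sparse cut of `G[B]` can be trimmed, paying for the removed volume with boundary edges. -/
theorem trim_step (G : SimpleGraph V) [Fintype V] [DecidableEq V]
    [DecidableRel G.Adj] (φ : ℝ) (A B : Finset V) (hφ0 : 0 < φ)
    (hA : IsNearlyExpanderIn G A φ) (hBA : B ⊆ A) (hB : ¬ IsExpanderOn G B (φ / 6)) :
    ∃ C ⊂ B, (interEdges G C (univ \ C) : ℝ) + 2 / 3 * φ * degSum G B ≤
      interEdges G B (univ \ B) + 2 / 3 * φ * degSum G C := by
  have key : ∃ S ⊆ B, degSum G S ≤ degSum G (B \ S) ∧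
      (interEdges G S (B \ S) : ℝ) < φ / 6 * degSum G S := by
    unfold IsExpanderOn at hB
    push Not at hB
    obtain ⟨S, hS, hlt⟩ := hB
    have h1 : (indDegSum G B S : ℝ) ≤ degSum G S := by
      exact_mod_cast indDegSum_le_degSum G B S
    have h2 : (indDegSum G B (B \ S) : ℝ) ≤ degSum G (B \ S) := by
      exact_mod_cast indDegSum_le_degSum G B (B \ S)
    have hp : 0 ≤ φ / 6 := by positivity
    rcases le_total (degSum G S) (degSum G (B \ S)) with hle | hle
    · exact ⟨S, hS, hle, hlt.trans_le
        (mul_le_mul_of_nonneg_left ((min_le_left _ _).trans h1) hp)⟩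
    · refine ⟨B \ S, Finset.sdiff_subset, ?_, ?_⟩
      · rwa [Finset.sdiff_sdiff_eq_self hS]
      · rw [Finset.sdiff_sdiff_eq_self hS, interEdges_symm]
        exact hlt.trans_le (mul_le_mul_of_nonneg_left ((min_le_right _ _).trans h2) hp)
  obtain ⟨S, hS, hle, hlt⟩ := key
  have hne : S.Nonempty := by
    rw [Finset.nonempty_iff_ne_empty]
    rintro rfl
    simp [interEdges, degSum] at hlt
  have hexp := hA S (hS.trans hBA) (by
    exact_mod_cast hle.trans (degSum_mono G (Finset.sdiff_subset_sdiff hBA subset_rfl)))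
  have hc : ((interEdges G (B \ S) (univ \ (B \ S)) : ℝ)) + interEdges G S (univ \ S) =
      interEdges G B (univ \ B) + 2 * interEdges G S (B \ S) := by
    exact_mod_cast cut_sdiff G B S hS
  have hd : (degSum G (B \ S) : ℝ) + degSum G S = degSum G B := by
    exact_mod_cast degSum_sdiff_add G B S hS
  refine ⟨B \ S, Finset.sdiff_ssubset hS hne, ?_⟩
  rw [← hd]
  linarith

theorem trim_exists (G : SimpleGraph V) [Fintype V] [DecidableEq V]
    [DecidableRel G.Adj] (φ : ℝ) (A : Finset V) (hφ0 : 0 < φ)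
    (hA : IsNearlyExpanderIn G A φ) (B : Finset V) (hBA : B ⊆ A) :
    ∃ C ⊆ B, IsExpanderOn G C (φ / 6) ∧
      (interEdges G C (univ \ C) : ℝ) + 2 / 3 * φ * degSum G B ≤
        interEdges G B (univ \ B) + 2 / 3 * φ * degSum G C := by
  induction B using Finset.strongInduction with
  | H B ih =>
    by_cases hB : IsExpanderOn G B (φ / 6)
    · exact ⟨B, subset_rfl, hB, le_rfl⟩
    · obtain ⟨C, hCB, hC⟩ := trim_step G φ A B hφ0 hA hBA hB
      obtain ⟨D, hDC, hD, hD'⟩ := ih C hCB (hCB.subset.trans hBA)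
      exact ⟨D, hDC.trans hCB.subset, hD, by linarith⟩

/-- **Parallel Trimming** (Lemma 3.1, existential content): if `G[A]` is a `φ`-nearly
expander in `G` and `|E(A, V∖A)| ≤ φ·m`, then there is `A' ⊆ A` such that `G[A']` is a
`φ/6`-expander, `deg_G(A') ≥ deg_G(A) − (4·(log₂ n)²/φ)·|E(A, V∖A)|`, and
`|E(A', V∖A')| ≤ 2·|E(A, V∖A)|`. -/
theorem parallel_trimming (G : SimpleGraph V) [Fintype V] [DecidableEq V]
    [DecidableRel G.Adj] (φ : ℝ) (A : Finset V)
    (hn : 2 ≤ Fintype.card V) (hφ0 : 0 < φ) (hφ1 : φ < 1)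
    (hA : IsNearlyExpanderIn G A φ)
    (hcut : (interEdges G A (Finset.univ \ A) : ℝ) ≤ φ * G.edgeFinset.card) :
    ∃ A' ⊆ A,
      IsExpanderOn G A' (φ / 6) ∧
      (degSum G A : ℝ) - 4 * Real.logb 2 (Fintype.card V) ^ 2 / φ *
          interEdges G A (Finset.univ \ A) ≤ degSum G A' ∧
      (interEdges G A' (Finset.univ \ A') : ℝ) ≤ 2 * interEdges G A (Finset.univ \ A) := by
  obtain ⟨C, hCA, hC, hle⟩ := trim_exists G φ A hφ0 hA A subset_rfl
  have hmono : (degSum G C : ℝ) ≤ degSum G A := by exact_mod_cast degSum_mono G hCA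
  have hk : (0 : ℝ) ≤ interEdges G A (Finset.univ \ A) := Nat.cast_nonneg _
  have hc : (0 : ℝ) ≤ interEdges G C (Finset.univ \ C) := Nat.cast_nonneg _
  refine ⟨C, hCA, hC, ?_, ?_⟩
  · have hlog : 1 ≤ Real.logb 2 (Fintype.card V) := by
      rw [Real.le_logb_iff_rpow_le (by norm_num) (by positivity)]
      simpa using (by exact_mod_cast hn : (2 : ℝ) ≤ Fintype.card V)
    have hsq : 1 ≤ Real.logb 2 (Fintype.card V) ^ 2 := one_le_pow₀ hlog
    have h1 : (degSum G A : ℝ) - degSum G C ≤ 4 / φ * interEdges G A (Finset.univ \ A) := by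
      rw [div_mul_eq_mul_div, le_div_iff₀ hφ0]
      nlinarith
    have h2 : 4 / φ * interEdges G A (Finset.univ \ A) ≤
        4 * Real.logb 2 (Fintype.card V) ^ 2 / φ * interEdges G A (Finset.univ \ A) := by
      gcongr
      linarith
    linarith
  · have := mul_le_mul_of_nonneg_left hmono (by positivity : 0 ≤ 2 / 3 * φ)
    linarith
end

section
/- Let G = (V, E) be a finite simple graph with n ≥ 2 vertices and m edges, let h ≥ 1 be an integer, let 0 < γ ≤ 1 and η ≥ 1, let c : E → ℝ≥0 with c(e) ≤ η for all e, let Δ : V → ℝ≥0 with Δ(v) ≤ η·deg_G(v) for all v and Σ_v Δ(v) ≤ 2m, and let ∇ : V → ℝ≥0 with ∇(v) ≥ γ·deg_G(v) for all v. Then there exist a feasible flow f (antisymmetric on oriented edges with |f(u,v)| ≤ c({u,v})) and a labeling l : V → {0, 1, …, h} such that: (i) for every edge {u, v}, if l(u) > l(v) + 1 then f saturates the edge in the direction from u to v, i.e. f(u,v) = c({u,v}); (ii) for every vertex u with l(u) ≥ 1, the amount of mass absorbed at u, namely Δ(u) + Σ_w f(w,u) truncated at ∇(u), is at least ∇(u)/(8·log₂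 n); and (iii) for every vertex u with l(u) < h, there is no excess mass at u, i.e. Δ(u) + Σ_w f(w,u) ≤ ∇(u). -/
open Finset

variable {V : Type}

/-- **Parallel Unit Flow** (Lemma 2.2, output-correctness content): under the stated
assumptions on capacities, sources and sinks, there exist a feasible flow `f` and a
labeling `l : V → {0, …, h}` satisfying properties (i)–(iii). -/
theorem parallel_unit_flow (G : SimpleGraph V) [Fintype V] [DecidableEq V]
    [DecidableRel G.Adj] (h : ℕ) (γ η : ℝ) (c : V → V → ℝ) (Δ snk : V → ℝ)
    (hn : 2 ≤ Fintype.card V) (hh : 1 ≤ h) (hγ0 : 0 < γ) (hγ1 : γ ≤ 1) (hη : 1 ≤ η)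
    (hcsymm : ∀ u v, c u v = c v u) (hc0 : ∀ u v, 0 ≤ c u v)
    (hcη : ∀ u v, G.Adj u v → c u v ≤ η)
    (hΔ0 : ∀ v, 0 ≤ Δ v) (hΔdeg : ∀ v, Δ v ≤ η * G.degree v)
    (hΔtot : ∑ v, Δ v ≤ 2 * (G.edgeFinset.card : ℝ))
    (hsnk : ∀ v, γ * (G.degree v : ℝ) ≤ snk v) :
    ∃ (f : V → V → ℝ) (l : V → ℕ),
      (∀ u v, f u v = - f v u) ∧
      (∀ u v, f u v ≠ 0 → G.Adj u v) ∧
      (∀ u v, G.Adj u v → |f u v| ≤ c u v) ∧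
      (∀ v, l v ≤ h) ∧
      -- (i) if `l(u) > l(v) + 1` for an edge `{u,v}`, the edge is saturated from `u` to `v`
      (∀ u v, G.Adj u v → l v + 1 < l u → f u v = c u v) ∧
      -- (ii) if `l(u) ≥ 1`, the sink of `u` is nearly saturated
      (∀ u, 1 ≤ l u →
        snk u / (8 * Real.logb 2 (Fintype.card V)) ≤ min (Δ u + ∑ w, f w u) (snk u)) ∧
      -- (iii) if `l(u) < h`, there is no excess mass at `u`
      (∀ u, l u < h → Δ u + ∑ w, f w u ≤ snk u) := by
  classical
  set K : Set (V → V → ℝ) := Set.Icc (fun u v => - c u v) (fun u v => c u v) ∩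
    {f | (∀ u v, f u v = - f v u) ∧ (∀ u v, ¬ G.Adj u v → f u v = 0)} with hK
  have hKc : IsCompact K := by
    refine isCompact_Icc.inter_right ?_
    have h1 : IsClosed {f : V → V → ℝ | ∀ u v, f u v = - f v u} := by
      simp only [Set.setOf_forall]
      exact isClosed_iInter fun u => isClosed_iInter fun v =>
        isClosed_eq (by fun_prop) (by fun_prop)
    have h2 : IsClosed {f : V → V → ℝ | ∀ u v, ¬ G.Adj u v → f u v = 0} := by
      simp only [Set.setOf_forall]
      exact isClosed_iInter fun u => isClosed_iInter fun v => isClosed_iInter fun _ =>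
        isClosed_eq (by fun_prop) (by fun_prop)
    exact h1.inter h2
  have hKne : K.Nonempty := by
    refine ⟨fun _ _ => 0, ⟨fun u v => ?_, fun u v => hc0 u v⟩, by simp, by simp⟩
    simpa using hc0 u v
  obtain ⟨f, hf, hmin⟩ := hKc.exists_isMinOn hKne
    (f := fun f : V → V → ℝ => ∑ x, (Δ x + ∑ w, f w x - snk x) ^ 2)
    (by fun_prop)
  obtain ⟨⟨hlo, hup⟩, hanti, hsupp⟩ := hf
  have hlo' : ∀ u v, - c u v ≤ f u v := fun u v => hlo u v
  have hup' : ∀ u v, f u v ≤ c u v := fun u v => hup u v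
  -- local optimality along a single residual edge
  have key : ∀ u v, G.Adj u v → f u v < c u v →
      Δ u + ∑ w, f w u - snk u ≤ Δ v + ∑ w, f w v - snk v := by
    intro u v huv hlt
    by_contra! hd
    have hne : u ≠ v := huv.ne
    set d : V → ℝ := fun x => Δ x + ∑ w, f w x - snk x with hdd
    have hd' : d v < d u := hd
    obtain ⟨ε, hε0, hε1, hε2⟩ : ∃ ε : ℝ, 0 < ε ∧ ε ≤ c u v - f u v ∧ ε < d u - d v := by
      refine ⟨min (c u v - f u v) ((d u - d v) / 2), lt_min (by linarith) (by linarith),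
        min_le_left _ _, lt_of_le_of_lt (min_le_right _ _) (by linarith)⟩
    set g : V → V → ℝ := fun w x => f w x + (if w = u then (if x = v then ε else 0) else 0)
      - (if w = v then (if x = u then ε else 0) else 0) with hg
    have hgK : g ∈ K := by
      have e1 := hanti u v
      have e2 := hcsymm u v
      refine ⟨⟨fun w x => ?_, fun w x => ?_⟩, fun w x => ?_, fun w x hwx => ?_⟩
      · have := hlo' w x
        have := hlo' u v
        simp only [hg]
        split_ifs <;> subst_vars <;> first | linarith | (exfalso; exact hne rfl)
      · have := hup' w x
        simp only [hg]
        split_ifs <;> subst_vars <;> first | linarith | (exfalso; exact hne rfl)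
      · have := hanti w x
        simp only [hg]
        split_ifs <;> linarith
      · have := hsupp w x hwx
        simp only [hg]
        split_ifs <;> subst_vars <;>
          first | linarith | (exfalso; exact hwx huv) | (exfalso; exact hwx huv.symm)
    have hm := hmin hgK
    simp only [Set.mem_setOf_eq] at hm
    have hs : ∀ x, Δ x + ∑ w, g w x - snk x
        = d x + ((if x = v then ε else 0) - (if x = u then ε else 0)) := by
      intro x
      simp only [hg, hdd, Finset.sum_sub_distrib, Finset.sum_add_distrib, Finset.sum_ite_eq',
        Finset.mem_univ, if_true]
      ring
    have hsq : ∀ x, (Δ x + ∑ w, g w x - snk x) ^ 2 = d x ^ 2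
        + (if x = v then 2 * ε * d x + ε ^ 2 else 0)
        + (if x = u then ε ^ 2 - 2 * ε * d x else 0) := by
      intro x
      rw [hs]
      by_cases hx : x = v
      · have : x ≠ u := fun e => hne (e.symm.trans hx)
        simp only [hx, if_true, if_neg hne.symm]
        ring
      · by_cases hx' : x = u
        · simp only [hx', if_true, if_neg hne]
          ring
        · simp [hx, hx']
    rw [Finset.sum_congr rfl (fun x _ => hsq x)] at hm
    simp only [Finset.sum_add_distrib, Finset.sum_ite_eq', Finset.mem_univ, if_true] at hm
    have : 0 < ε * (d u - d v - ε) := mul_pos hε0 (by linarith)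
    have h0 : ∑ x, (Δ x + ∑ w, f w x - snk x) ^ 2 = ∑ x, d x ^ 2 := rfl
    nlinarith
  refine ⟨f, fun x => if 0 < Δ x + ∑ w, f w x - snk x then h else 0, hanti, ?_, ?_, ?_, ?_, ?_, ?_⟩
  · intro u v huv
    by_contra hna
    exact huv (hsupp u v hna)
  · exact fun u v _ => abs_le.2 ⟨hlo' u v, hup' u v⟩
  · intro v
    dsimp only
    split_ifs <;> omega
  · intro u v huv hl
    by_contra hne
    have hk := key u v huv (lt_of_le_of_ne (hup' u v) hne)
    dsimp only at hl
    split_ifs at hl <;> first | omega | linarith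
  · intro u hu
    dsimp only at hu
    split_ifs at hu with hpos
    · have hs0 : 0 ≤ snk u := le_trans (by positivity) (hsnk u)
      have hlog : 1 ≤ Real.logb 2 (Fintype.card V) := by
        rw [Real.le_logb_iff_rpow_le (by norm_num) (by positivity)]
        simpa using (by exact_mod_cast hn : (2 : ℝ) ≤ Fintype.card V)
      have hle : snk u / (8 * Real.logb 2 (Fintype.card V)) ≤ snk u :=
        div_le_self hs0 (by linarith)
      exact le_min (by linarith) hle
    · omega
  · intro u hu
    dsimp only at hu
    split_ifs at hu with hpos
    · omega
    · linarith
end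

section
/- There exist universal constants c₁ > 0 and c₂ > 0 such that the following holds. Let G = (V, E) be a finite simple graph on n ≥ 2 vertices with m edges and maximum degree at most 16, let 0 < φ < 1, and let S, T ⊆ V with |S| ≤ |T|. Then there exist a set C ⊆ V and a collection 𝒫 of paths in G, each starting at a vertex of S and ending at a vertex of T, with pairwise distinct starting vertices and pairwise distinct ending vertices (so 𝒫 embeds a matching between S and T), such that: (1) every edge of G appears on at most c₁·(log n)^{c₂}/φ of the paths in 𝒫; (2) C contains every vertex of S that is not the starting vertex of a path in 𝒫; (3) C contains no vertex of T that is not the ending vertex of a path in 𝒫; and (4) either C = ∅ or |E_G(C, V∖C)| ≤ φ·deg_G(C) + 2·φ·m. -/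
open Finset

variable {V : Type}

namespace CutMatch

variable {V : Type} [Fintype V] [DecidableEq V] {G : SimpleGraph V}

/-- The signed unit flow along a walk. -/
def wflow : ∀ {s t : V}, G.Walk s t → V → V → ℤ
  | _, _, .nil => fun _ _ => 0
  | s, _, .cons (v := w) _ p => fun u v =>
      (if u = s ∧ v = w then 1 else 0) - (if u = w ∧ v = s then 1 else 0) + wflow p u v

lemma wflow_skew {s t : V} (p : G.Walk s t) (u v : V) : wflow p v u = - wflow p u v := by
  induction p with
  | nil => simp [wflow]
  | cons h p ih =>
    simp only [wflow, ih]
    simp only [and_comm (a := v = _)]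
    ring

lemma wflow_zero {s t : V} (p : G.Walk s t) (u v : V) (h : s(u, v) ∉ p.edges) :
    wflow p u v = 0 := by
  induction p with
  | nil => simp [wflow]
  | cons h' p ih =>
    simp only [SimpleGraph.Walk.edges_cons, List.mem_cons, not_or, Sym2.eq_iff] at h
    simp only [wflow, ih h.2]
    rw [if_neg (by tauto), if_neg (by tauto)]
    ring

lemma wflow_one {s t : V} (p : G.Walk s t) (hp : p.IsTrail) (d : G.Dart) (hd : d ∈ p.darts) :
    wflow p d.fst d.snd = 1 := by
  induction p with
  | nil => simp at hd
  | @cons a b _ h p ih =>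
    rw [SimpleGraph.Walk.isTrail_cons] at hp
    simp only [SimpleGraph.Walk.darts_cons, List.mem_cons] at hd
    have hab := h.ne
    rcases hd with rfl | hd
    · simp only [wflow]
      rw [wflow_zero p _ _ hp.2]
      simp [hab]
    · have he : s(d.fst, d.snd) ∈ p.edges := by
        have := List.mem_map_of_mem (f := SimpleGraph.Dart.edge) hd
        exact this
      have hne : s(d.fst, d.snd) ≠ s(a, b) := fun hh => hp.2 (hh ▸ he)
      rw [Ne, Sym2.eq_iff] at hne
      simp only [wflow, ih hp.1 hd]
      rw [if_neg (by tauto), if_neg (by tauto)]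
      ring

lemma wflow_div {s t : V} (p : G.Walk s t) (u : V) :
    ∑ v, wflow p u v = (if u = s then 1 else 0) - (if u = t then 1 else 0) := by
  induction p with
  | nil => simp [wflow]
  | cons h p ih =>
    simp only [wflow, Finset.sum_add_distrib, Finset.sum_sub_distrib, ih, ite_and]
    simp only [Finset.sum_ite_irrel, Finset.sum_ite_eq', Finset.mem_univ, Finset.sum_const_zero]
    split_ifs <;> simp_all

/-- Each edge of a walk comes from a dart, in one of the two directions. -/
lemma edge_dart {s t : V} (p : G.Walk s t) (u v : V) (h : s(u, v) ∈ p.edges) :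
    (∃ d ∈ p.darts, d.fst = u ∧ d.snd = v) ∨ (∃ d ∈ p.darts, d.fst = v ∧ d.snd = u) := by
  obtain ⟨d, hd, he⟩ := List.mem_map.1 h
  have he' : s(d.fst, d.snd) = s(u, v) := he
  rw [Sym2.eq_iff] at he'
  rcases he' with h | h
  · exact Or.inl ⟨d, hd, h⟩
  · exact Or.inr ⟨d, hd, h⟩

/-- Reachability along a relation contained in adjacency yields a path. -/
lemma exists_path (r : V → V → Prop) (hr : ∀ u v, r u v → G.Adj u v) {s t : V}
    (h : Relation.ReflTransGen r s t) :
    ∃ p : G.Walk s t, p.IsPath ∧ ∀ d ∈ p.darts, r d.fst d.snd := by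
  have : ∃ p : G.Walk s t, ∀ d ∈ p.darts, r d.fst d.snd := by
    induction h using Relation.ReflTransGen.head_induction_on with
    | refl => exact ⟨.nil, by simp⟩
    | @head a b hab _ ih =>
      obtain ⟨p, hp⟩ := ih
      refine ⟨.cons (hr _ _ hab) p, ?_⟩
      intro d hd
      simp only [SimpleGraph.Walk.darts_cons, List.mem_cons] at hd
      rcases hd with rfl | hd
      · exact hab
      · exact hp d hd
  obtain ⟨p, hp⟩ := this
  exact ⟨p.bypass, p.bypass_isPath, fun d hd => hp d (p.darts_bypass_subset_darts hd)⟩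

/-- Net flow out of a set. -/
lemma sum_div (f : V → V → ℤ) (hs : ∀ u v, f v u = - f u v) (C : Finset V) :
    ∑ u ∈ C, ∑ v, f u v = ∑ u ∈ C, ∑ v ∈ Finset.univ \ C, f u v := by
  have h0 : ∑ u ∈ C, ∑ v ∈ C, f u v = 0 := by
    have h1 : ∑ u ∈ C, ∑ v ∈ C, f u v = - ∑ u ∈ C, ∑ v ∈ C, f u v := by
      conv_lhs => rw [Finset.sum_comm]
      simp only [← Finset.sum_neg_distrib]
      exact Finset.sum_congr rfl fun u _ => Finset.sum_congr rfl fun v _ => hs _ _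
    linarith
  have h2 : ∀ u, ∑ v, f u v = ∑ v ∈ Finset.univ \ C, f u v + ∑ v ∈ C, f u v := fun u =>
    (Finset.sum_sdiff (Finset.subset_univ C)).symm
  simp only [h2, Finset.sum_add_distrib, h0, add_zero]

/-- Indicator. -/
def ind (A : Finset V) (u : V) : ℤ := if u ∈ A then 1 else 0

lemma decomp (k : ℕ) : ∀ (A B : Finset V) (f : V → V → ℤ), A.card = k → B.card = k →
    (∀ u v, f v u = - f u v) → (∀ u v, ¬ G.Adj u v → f u v = 0) →
    (∀ u, ∑ v, f u v = ind A u - ind B u) →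
    ∃ Q : ∀ v : V, Σ w, G.Walk v w, (∀ a ∈ A, (Q a).1 ∈ B ∧ (Q a).2.IsPath) ∧
      Set.InjOn (fun a => (Q a).1) A ∧
      ∀ u v, ((A.filter fun a => s(u, v) ∈ (Q a).2.edges).card : ℤ) ≤ |f u v| := by
  induction k with
  | zero =>
    intro A B f hA hB _ _ _
    rw [Finset.card_eq_zero] at hA
    subst hA
    exact ⟨fun v => ⟨v, .nil⟩, by simp, by simp, by simp⟩
  | succ k ih =>
    intro A B f hA hB hs hadj hdiv
    obtain ⟨a, ha⟩ : A.Nonempty := Finset.card_pos.1 (by omega)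
    let r : V → V → Prop := fun u v => 0 < f u v
    have hr : ∀ u v, r u v → G.Adj u v := by
      intro u v h
      by_contra h'
      have := hadj u v h'
      simp only [r] at h
      omega
    classical
    let R : Finset V := Finset.univ.filter fun v => Relation.ReflTransGen r a v
    have hb : ∃ b ∈ B, Relation.ReflTransGen r a b := by
      by_contra hcon
      push Not at hcon
      have h1 := sum_div f hs R
      have h2 : ∑ u ∈ R, ∑ v ∈ Finset.univ \ R, f u v ≤ 0 := by
        refine Finset.sum_nonpos fun u hu => Finset.sum_nonpos fun v hv => ?_
        by_contra hlt
        simp only [R, Finset.mem_filter, Finset.mem_univ, true_and, Finset.mem_sdiff] at hu hv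
        exact hv (hu.tail (not_le.1 hlt))
      have h3 : 0 < ∑ u ∈ R, ∑ v, f u v := by
        refine Finset.sum_pos' ?_ ⟨a, by simp [R, Relation.ReflTransGen.refl], ?_⟩
        · intro u hu
          simp only [R, Finset.mem_filter, Finset.mem_univ, true_and] at hu
          have : u ∉ B := fun h => hcon u h hu
          rw [hdiv, ind, ind, if_neg this]
          split_ifs <;> simp
        · have : a ∉ B := fun h => hcon a h .refl
          rw [hdiv, ind, ind, if_neg this, if_pos ha]
          simp
      linarith
    obtain ⟨b, hbB, hab⟩ := hb
    obtain ⟨p, hp, hpd⟩ := exists_path r hr hab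
    have hval : ∀ u v, s(u, v) ∈ p.edges → |f u v - wflow p u v| + 1 ≤ |f u v| := by
      intro u v huv
      rcases edge_dart p u v huv with ⟨d, hd, rfl, rfl⟩ | ⟨d, hd, rfl, rfl⟩
      · have h1 := wflow_one p hp.isTrail d hd
        have h2 : 0 < f d.fst d.snd := hpd d hd
        rw [h1, abs_of_nonneg (by omega), abs_of_nonneg (by omega)]
        omega
      · have h1 := wflow_one p hp.isTrail d hd
        have h2 : 0 < f d.fst d.snd := hpd d hd
        rw [wflow_skew, hs, h1, abs_of_nonpos (by omega), abs_of_nonpos (by omega)]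
        omega
    obtain ⟨Q, hQ1, hQ2, hQ3⟩ := ih (A.erase a) (B.erase b) (fun u v => f u v - wflow p u v)
      (by rw [Finset.card_erase_of_mem ha]; omega) (by rw [Finset.card_erase_of_mem hbB]; omega)
      (by intro u v; simp only [hs u v, wflow_skew p u v]; ring)
      (by
        intro u v huv
        simp only [hadj u v huv]
        rw [wflow_zero]
        · simp
        · exact fun h => huv (p.adj_of_mem_edges h))
      (by
        intro u
        rw [Finset.sum_sub_distrib, hdiv, wflow_div]
        simp only [ind, Finset.mem_erase]
        clear hdiv hadj hs hval hpd
        grind)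
    refine ⟨Function.update Q a ⟨b, p⟩, ?_, ?_, ?_⟩
    · intro x hx
      by_cases hxa : x = a
      · subst hxa
        rw [Function.update_self]
        exact ⟨hbB, hp⟩
      · rw [Function.update_of_ne hxa]
        have := hQ1 x (Finset.mem_erase.2 ⟨hxa, hx⟩)
        exact ⟨Finset.mem_of_mem_erase this.1, this.2⟩
    · intro x hx y hy hxy
      simp only at hxy
      by_cases hxa : x = a <;> by_cases hya : y = a
      · rw [hxa, hya]
      · subst hxa
        rw [Function.update_self, Function.update_of_ne hya] at hxy
        have := (hQ1 y (Finset.mem_erase.2 ⟨hya, hy⟩)).1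
        rw [← hxy] at this
        simp at this
      · subst hya
        rw [Function.update_self, Function.update_of_ne hxa] at hxy
        have := (hQ1 x (Finset.mem_erase.2 ⟨hxa, hx⟩)).1
        rw [hxy] at this
        simp at this
      · rw [Function.update_of_ne hxa, Function.update_of_ne hya] at hxy
        exact hQ2 (Finset.mem_coe.2 (Finset.mem_erase.2 ⟨hxa, hx⟩))
          (Finset.mem_coe.2 (Finset.mem_erase.2 ⟨hya, hy⟩)) hxy
    · intro u v
      have h3 := hQ3 u v
      have hE : ((A.erase a).filter fun x => s(u, v) ∈ (Function.update Q a ⟨b, p⟩ x).2.edges)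
          = (A.erase a).filter fun x => s(u, v) ∈ (Q x).2.edges := by
        refine Finset.filter_congr fun x hx => ?_
        rw [Function.update_of_ne (Finset.ne_of_mem_erase hx)]
      rw [← Finset.insert_erase ha, Finset.filter_insert, hE, Function.update_self]
      split_ifs with h
      · have := hval u v h
        have h4 := Finset.card_insert_le a ((A.erase a).filter fun x => s(u, v) ∈ (Q x).2.edges)
        zify at h4
        linarith
      · rw [wflow_zero p u v h] at h3
        simpa using h3

/-- Existence of a feasible integral flow of value `k`. -/
def Feas (G : SimpleGraph V) (c : ℤ) (S T A B : Finset V) (f : V → V → ℤ) : Prop :=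
  A ⊆ S ∧ B ⊆ T ∧ A.card = B.card ∧ (∀ u v, f v u = - f u v) ∧
    (∀ u v, ¬ G.Adj u v → f u v = 0) ∧ (∀ u v, f u v ≤ c) ∧
    ∀ u, ∑ v, f u v = ind A u - ind B u

lemma exists_max (G : SimpleGraph V) (c : ℤ) (hc : 0 ≤ c) (S T : Finset V) :
    ∃ A B f, Feas G c S T A B f ∧ ∀ A' B' f', Feas G c S T A' B' f' → A'.card ≤ A.card := by
  classical
  let Pr : ℕ → Prop := fun k => ∃ A B f, Feas G c S T A B f ∧ A.card = k
  have h0 : Pr 0 := ⟨∅, ∅, fun _ _ => 0, by simp [Feas, hc, ind], rfl⟩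
  obtain ⟨A, B, f, hf, hA⟩ := Nat.findGreatest_spec (P := Pr) (Nat.zero_le S.card) h0
  refine ⟨A, B, f, hf, fun A' B' f' hf' => ?_⟩
  rw [hA]
  exact Nat.le_findGreatest (Finset.card_le_card hf'.1) ⟨A', B', f', hf', rfl⟩

lemma main_flow (G : SimpleGraph V) [DecidableRel G.Adj] (c : ℤ) (hc : 0 ≤ c) (S T : Finset V) :
    ∃ A B f, Feas G c S T A B f ∧ ∃ C : Finset V, (∀ v ∈ S, v ∉ A → v ∈ C) ∧
      (∀ v ∈ T, v ∉ B → v ∉ C) ∧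
      c * (interEdges G C (Finset.univ \ C) : ℤ) ≤ degSum G C := by
  classical
  obtain ⟨A, B, f, hf, hmax⟩ := exists_max G c hc S T
  refine ⟨A, B, f, hf, ?_⟩
  obtain ⟨hAS, hBT, hAB, hs, hadj, hcap, hdiv⟩ := hf
  let r : V → V → Prop := fun u v => G.Adj u v ∧ f u v < c
  let C : Finset V := Finset.univ.filter fun v => ∃ s ∈ S, s ∉ A ∧ Relation.ReflTransGen r s v
  have hC : ∀ v, v ∈ C ↔ ∃ s ∈ S, s ∉ A ∧ Relation.ReflTransGen r s v := by simp [C]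
  refine ⟨C, ?_, ?_, ?_⟩
  · exact fun v hv hvA => (hC v).2 ⟨v, hv, hvA, .refl⟩
  · intro t ht htB htC
    obtain ⟨s, hsS, hsA, hst⟩ := (hC t).1 htC
    obtain ⟨p, hp, hpd⟩ := exists_path r (fun _ _ h => h.1) hst
    have := hmax (insert s A) (insert t B) (fun u v => f u v + wflow p u v) ⟨
      Finset.insert_subset hsS hAS, Finset.insert_subset ht hBT,
      by rw [Finset.card_insert_of_notMem hsA, Finset.card_insert_of_notMem htB, hAB],
      by intro u v; simp only [hs u v, wflow_skew p u v]; ring,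
      by
        intro u v huv
        simp only [hadj u v huv]
        rw [wflow_zero]
        · simp
        · exact fun h => huv (p.adj_of_mem_edges h),
      by
        intro u v
        by_cases huv : s(u, v) ∈ p.edges
        · rcases edge_dart p u v huv with ⟨d, hd, rfl, rfl⟩ | ⟨d, hd, rfl, rfl⟩
          · have h1 := wflow_one p hp.isTrail d hd
            have h2 := (hpd d hd).2
            simp only [h1]
            omega
          · have h1 := wflow_one p hp.isTrail d hd
            have h2 := hcap d.snd d.fst
            simp only [wflow_skew p d.fst d.snd, h1]
            omega
        · simp only [wflow_zero p u v huv, add_zero]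
          exact hcap u v,
      by
        intro u
        rw [Finset.sum_add_distrib, hdiv, wflow_div]
        simp only [ind, Finset.mem_insert]
        clear hdiv hadj hs hcap hpd hmax
        grind⟩
    rw [Finset.card_insert_of_notMem hsA] at this
    omega
  · have h1 := sum_div f hs C
    have h2 : ∑ u ∈ C, ∑ v ∈ Finset.univ \ C, f u v
        = c * (interEdges G C (Finset.univ \ C) : ℤ) := by
      have : ∀ u ∈ C, ∀ v ∈ Finset.univ \ C, f u v = if G.Adj u v then c else 0 := by
        intro u hu v hv
        split_ifs with h
        · refine le_antisymm (hcap u v) ?_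
          by_contra hlt
          obtain ⟨s, hsS, hsA, hsu⟩ := (hC u).1 hu
          exact (Finset.mem_sdiff.1 hv).2
            ((hC v).2 ⟨s, hsS, hsA, hsu.tail ⟨h, not_le.1 hlt⟩⟩)
        · exact hadj u v h
      rw [Finset.sum_congr rfl fun u hu => Finset.sum_congr rfl (this u hu)]
      rw [← Finset.sum_product' (f := fun u v => if G.Adj u v then c else 0)]
      rw [← Finset.sum_filter, Finset.sum_const, interEdges, nsmul_eq_mul, mul_comm]
    rw [← h2, ← h1, degSum]
    push_cast
    refine Finset.sum_le_sum fun u _ => ?_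
    by_cases hd : G.degree u = 0
    · have : ∀ v, f u v = 0 := by
        intro v
        apply hadj
        intro h
        have : 0 < G.degree u := (G.degree_pos_iff_exists_adj u).2 ⟨v, h⟩
        omega
      simp [this]
    · have h3 : ∑ v, f u v ≤ 1 := by
        rw [hdiv]
        simp only [ind]
        split_ifs <;> simp
      have : (1 : ℤ) ≤ G.degree u := by exact_mod_cast Nat.one_le_iff_ne_zero.2 hd
      linarith

end CutMatch

/-- **Alternative cut-or-match** (Theorem 5, existential content): there are universal
constants `c₁, c₂ > 0` such that for every graph of max degree `≤ 16`, `φ ∈ (0,1)` and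
`S, T` with `|S| ≤ |T|`, there are a cut `C` and a collection of vertex-disjointly-ended
`S`-`T` paths embedding a matching, with congestion `c₁·(log n)^{c₂}/φ`, such that `C`
contains all unmatched sources, no unmatched sinks, and `C = ∅` or
`|E_G(C, V∖C)| ≤ φ·deg_G(C) + 2·φ·m`. -/
theorem cut_or_match :
    ∃ c₁ c₂ : ℝ, 0 < c₁ ∧ 0 < c₂ ∧
      ∀ (V : Type) [Fintype V] [DecidableEq V] (G : SimpleGraph V) [DecidableRel G.Adj]
        (φ : ℝ) (S T : Finset V),
        2 ≤ Fintype.card V → (∀ v : V, G.degree v ≤ 16) → 0 < φ → φ < 1 →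
        S.card ≤ T.card →
        ∃ (C : Finset V) (k : ℕ) (a b : Fin k → V) (P : ∀ i, G.Walk (a i) (b i)),
          (∀ i, (P i).IsPath) ∧
          (∀ i, a i ∈ S) ∧ (∀ i, b i ∈ T) ∧
          Function.Injective a ∧ Function.Injective b ∧
          -- (1) congestion: every edge lies on at most `c₁·(log n)^{c₂}/φ` paths
          (∀ e ∈ G.edgeFinset,
            ((Finset.univ.filter fun i => e ∈ (P i).edges).card : ℝ) ≤
              c₁ * Real.log (Fintype.card V) ^ c₂ / φ) ∧
          -- (2) `C` contains every unmatched source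
          (∀ v ∈ S, (∀ i, a i ≠ v) → v ∈ C) ∧
          -- (3) `C` contains no unmatched sink
          (∀ v ∈ T, (∀ i, b i ≠ v) → v ∉ C) ∧
          -- (4) the cut is empty or sparse
          (C = ∅ ∨ (interEdges G C (Finset.univ \ C) : ℝ) ≤
            φ * degSum G C + 2 * φ * G.edgeFinset.card) := by
  refine ⟨4, 1, by norm_num, by norm_num, ?_⟩
  intro V _ _ G _ φ S T hn _ hφ hφ1 _
  set c : ℕ := ⌈1 / φ⌉₊ with hcdef
  have hc1 : 1 / φ ≤ c := Nat.le_ceil _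
  have hc2 : (c : ℝ) < 1 / φ + 1 := Nat.ceil_lt_add_one (by positivity)
  obtain ⟨A, B, f, hf, C, hC1, hC2, hC3⟩ := CutMatch.main_flow G (c : ℤ) (by positivity) S T
  obtain ⟨hAS, hBT, hAB, hs, hadj, hcap, hdiv⟩ := hf
  obtain ⟨Q, hQ1, hQ2, hQ3⟩ := CutMatch.decomp A.card A B f rfl hAB.symm hs hadj hdiv
  let e := A.equivFin.symm
  refine ⟨C, A.card, fun i => (e i : V), fun i => (Q (e i)).1, fun i => (Q (e i)).2, ?_, ?_, ?_,
    ?_, ?_, ?_, ?_, ?_, Or.inr ?_⟩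
  · exact fun i => (hQ1 _ (e i).2).2
  · exact fun i => hAS (e i).2
  · exact fun i => hBT (hQ1 _ (e i).2).1
  · exact fun i j h => e.injective (Subtype.ext h)
  · exact fun i j h => e.injective (Subtype.ext (hQ2 (e i).2 (e j).2 h))
  · intro x hx
    induction x using Sym2.ind with
    | _ u v =>
    have h1 : (Finset.univ.filter fun i => s(u, v) ∈ (Q (e i)).2.edges).card
        ≤ (A.filter fun a => s(u, v) ∈ (Q a).2.edges).card := by
      refine Finset.card_le_card_of_injOn (fun i => (e i : V)) ?_ ?_
      · intro i hi
        simp only [Finset.coe_filter, Finset.mem_univ, true_and, Set.mem_ofPred_eq] at hi ⊢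
        exact ⟨(e i).2, hi⟩
      · exact fun i _ j _ h => e.injective (Subtype.ext h)
    have h2 : |f u v| ≤ c := abs_le.2 ⟨by have := hcap v u; have := hs u v; omega, hcap u v⟩
    have h3 : (Finset.univ.filter fun i => s(u, v) ∈ (Q (e i)).2.edges).card ≤ c := by
      have := hQ3 u v
      omega
    have h4 : ((Finset.univ.filter fun i => s(u, v) ∈ (Q (e i)).2.edges).card : ℝ) ≤ c := by
      exact_mod_cast h3
    refine h4.trans ?_
    have h5 : Real.log 2 ≤ Real.log (Fintype.card V) :=
      Real.log_le_log (by norm_num) (by exact_mod_cast hn)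
    have h6 := Real.log_two_gt_d9
    have h7 : (1 : ℝ) ≤ 1 / φ := by rw [le_div_iff₀ hφ]; linarith
    rw [Real.rpow_one]
    have h8 : 2 * (1 / φ) ≤ 4 * Real.log (Fintype.card V) / φ := by
      rw [mul_one_div]
      gcongr
      linarith
    linarith
  · intro v hv h
    refine hC1 v hv fun hvA => ?_
    exact h (e.symm ⟨v, hvA⟩) (by simp)
  · intro v hv h
    refine hC2 v hv fun hvB => ?_
    have himg : A.image (fun a => (Q a).1) = B := by
      refine Finset.eq_of_subset_of_card_le ?_ ?_
      · exact Finset.image_subset_iff.2 fun a ha => (hQ1 a ha).1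
      · rw [Finset.card_image_of_injOn hQ2, hAB]
    rw [← himg] at hvB
    obtain ⟨a, ha, hav⟩ := Finset.mem_image.1 hvB
    obtain ⟨i, hi⟩ := e.surjective ⟨a, ha⟩
    have hi' : (e i : V) = a := by rw [hi]
    subst hi'
    exact h i hav
  · have h1 : (c : ℝ) * (interEdges G C (Finset.univ \ C) : ℝ) ≤ degSum G C := by
      exact_mod_cast hC3
    have h2 : 1 / φ * (interEdges G C (Finset.univ \ C) : ℝ) ≤ degSum G C :=
      (mul_le_mul_of_nonneg_right hc1 (Nat.cast_nonneg _)).trans h1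
    have h3 : (interEdges G C (Finset.univ \ C) : ℝ) ≤ φ * degSum G C := by
      have := mul_le_mul_of_nonneg_left h2 hφ.le
      rwa [← mul_assoc, mul_one_div_cancel hφ.ne', one_mul] at this
    have : 0 ≤ 2 * φ * (G.edgeFinset.card : ℝ) :=
      mul_nonneg (mul_nonneg (by norm_num) hφ.le) (Nat.cast_nonneg _)
    linarith
end
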